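/- For any δ ≥ 0 and any U, U* ∈ ℝ^{m×r}, V, V* ∈ ℝ^{n×r}, writing W = [U; V], W* = [U*; V*], W̃ = [U; −V], W̃* = [U*; −V*]: (1−δ)·‖UVᵀ − U*V*ᵀ‖_F² + (1/4)·⟨W̃W̃ᵀ − W̃*W̃*ᵀ, WWᵀ − W*W*ᵀ⟩ ≥ ((1−2δ)/4)·‖WWᵀ − W*W*ᵀ‖_F². Equivalently, the left-hand side equals (1−δ−1/2)·‖UVᵀ − U*V*ᵀ‖_F² + (1/4)·‖UUᵀ − U*U*ᵀ‖_F² + (1/4)·‖VVᵀ − V*V*ᵀ‖_F², which is at least the right-hand side. -/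

import Mathlib

open Matrix BigOperators

noncomputable section

/-- Trace inner product `⟨X, Y⟩ = trace (Xᵀ * Y) = ∑ᵢⱼ Xᵢⱼ Yᵢⱼ`. -/
def ip {α β : Type*} [Fintype α] [Fintype β] (X Y : Matrix α β ℝ) : ℝ :=
  ∑ i, ∑ j, X i j * Y i j

/-- Frobenius norm. -/
def fnorm {α β : Type*} [Fintype α] [Fintype β] (X : Matrix α β ℝ) : ℝ :=
  Real.sqrt (∑ i, ∑ j, X i j ^ 2)

/-- Euclidean (ℓ₂) norm of a vector. -/
def vnorm {α : Type*} [Fintype α] (x : α → ℝ) : ℝ :=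
  Real.sqrt (∑ i, x i ^ 2)

/-- The linear operator `𝒜(X)ᵢ = ⟨Aᵢ, X⟩` satisfies the restricted isometry property on
rank-`k` matrices with parameter `δ`. -/
def RIP {m n p : ℕ} (A : Fin p → Matrix (Fin m) (Fin n) ℝ) (k : ℕ) (δ : ℝ) : Prop :=
  ∀ X : Matrix (Fin m) (Fin n) ℝ, X.rank ≤ k →
    (1 - δ) * fnorm X ^ 2 ≤ ∑ i, ip (A i) X ^ 2 ∧
      ∑ i, ip (A i) X ^ 2 ≤ (1 + δ) * fnorm X ^ 2

/-- Vertical stacking `[U; V]`. -/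
def stack {m n r : ℕ} (U : Matrix (Fin m) (Fin r) ℝ) (V : Matrix (Fin n) (Fin r) ℝ) :
    Matrix (Fin m ⊕ Fin n) (Fin r) ℝ :=
  Matrix.fromRows U V

/-- For `Z = [Z_U; Z_V]`, `tilde Z = [Z_U; -Z_V]` (negate the bottom block). -/
def tilde {m n r : ℕ} (Z : Matrix (Fin m ⊕ Fin n) (Fin r) ℝ) :
    Matrix (Fin m ⊕ Fin n) (Fin r) ℝ :=
  Matrix.of (Sum.elim (fun i j => Z (Sum.inl i) j) (fun i j => -Z (Sum.inr i) j))

/-- `Bᵢ = (1/2) · [[0, Aᵢ], [Aᵢᵀ, 0]]`. -/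
def Bmat {m n p : ℕ} (A : Fin p → Matrix (Fin m) (Fin n) ℝ) (i : Fin p) :
    Matrix (Fin m ⊕ Fin n) (Fin m ⊕ Fin n) ℝ :=
  (1 / 2 : ℝ) • Matrix.fromBlocks 0 (A i) (A i)ᵀ 0

/-- `(U, V)` is a balanced ("equally-footed") factorization of `X`: for some SVD
`X = A · diagonal S · Bᵀ` (with `A, B` having orthonormal columns and `S` the nonnegative
singular values) and some orthonormal `R`, `U = A · S^{1/2} · R` and `V = B · S^{1/2} · R`. -/
def IsBalanced {m n r : ℕ} (X : Matrix (Fin m) (Fin n) ℝ)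
    (U : Matrix (Fin m) (Fin r) ℝ) (V : Matrix (Fin n) (Fin r) ℝ) : Prop :=
  ∃ (A : Matrix (Fin m) (Fin r) ℝ) (B : Matrix (Fin n) (Fin r) ℝ)
    (S : Fin r → ℝ) (R : Matrix (Fin r) (Fin r) ℝ),
      Aᵀ * A = 1 ∧ Bᵀ * B = 1 ∧ (∀ i, 0 ≤ S i) ∧ Rᵀ * R = 1 ∧ R * Rᵀ = 1 ∧
      X = A * Matrix.diagonal S * Bᵀ ∧
      U = A * Matrix.diagonal (fun i => Real.sqrt (S i)) * R ∧
      V = B * Matrix.diagonal (fun i => Real.sqrt (S i)) * R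

/-- `Dist(U, V; X) = min ‖[U; V] − [U*; V*]‖_F` over balanced factorizations `(U*, V*)` of `X`. -/
def distW {m n r : ℕ} (U : Matrix (Fin m) (Fin r) ℝ) (V : Matrix (Fin n) (Fin r) ℝ)
    (X : Matrix (Fin m) (Fin n) ℝ) : ℝ :=
  sInf {d : ℝ | ∃ (U' : Matrix (Fin m) (Fin r) ℝ) (V' : Matrix (Fin n) (Fin r) ℝ),
    IsBalanced X U' V' ∧ d = fnorm (stack U V - stack U' V')}

/-- First-order optimality condition for `f + g` at `W = [U; V]`:
`∑ᵢ (⟨Bᵢ, WWᵀ⟩ − bᵢ) Bᵢ W + (1/4) W̃ W̃ᵀ W = 0`. -/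
def FirstOrderOpt {m n r p : ℕ} (A : Fin p → Matrix (Fin m) (Fin n) ℝ) (b : Fin p → ℝ)
    (U : Matrix (Fin m) (Fin r) ℝ) (V : Matrix (Fin n) (Fin r) ℝ) : Prop :=
  (∑ i, (ip (Bmat A i) (stack U V * (stack U V)ᵀ) - b i) • (Bmat A i * stack U V))
    + (1 / 4 : ℝ) • (stack U (-V) * (stack U (-V))ᵀ * stack U V) = 0

/-- The Hessian quadratic form of `f + g` at `W = [U; V]` in direction `Z`. -/
def hessForm {m n r p : ℕ} (A : Fin p → Matrix (Fin m) (Fin n) ℝ) (b : Fin p → ℝ)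
    (U : Matrix (Fin m) (Fin r) ℝ) (V : Matrix (Fin n) (Fin r) ℝ)
    (Z : Matrix (Fin m ⊕ Fin n) (Fin r) ℝ) : ℝ :=
  (∑ i, ip (Bmat A i) (Z * (stack U V)ᵀ + stack U V * Zᵀ) * ip (Bmat A i) (Z * (stack U V)ᵀ))
    + (∑ i, (ip (Bmat A i) (stack U V * (stack U V)ᵀ) - b i) * ip (Bmat A i) (Z * Zᵀ))
    + (1 / 4 : ℝ) * ip (tilde Z * (stack U (-V))ᵀ + stack U (-V) * (tilde Z)ᵀ)
        (Z * (stack U V)ᵀ)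
    + (1 / 4 : ℝ) * ip (stack U (-V) * (stack U (-V))ᵀ) (Z * Zᵀ)

/-- Second-order optimality condition for `f + g` at `W = [U; V]`: the Hessian quadratic
form is nonnegative in every direction `Z = [Z_U; Z_V]`. -/
def SecondOrderOpt {m n r p : ℕ} (A : Fin p → Matrix (Fin m) (Fin n) ℝ) (b : Fin p → ℝ)
    (U : Matrix (Fin m) (Fin r) ℝ) (V : Matrix (Fin n) (Fin r) ℝ) : Prop :=
  ∀ Z : Matrix (Fin m ⊕ Fin n) (Fin r) ℝ, 0 ≤ hessForm A b U V Z

theorem fnorm_sq {α β : Type*} [Fintype α] [Fintype β] (X : Matrix α β ℝ) :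
    fnorm X ^ 2 = ip X X := by
  simp only [fnorm, ip, ← pow_two]
  exact Real.sq_sqrt (by positivity)

theorem ip_self_nonneg {α β : Type*} [Fintype α] [Fintype β] (X : Matrix α β ℝ) :
    0 ≤ ip X X :=
  Finset.sum_nonneg fun _ _ => Finset.sum_nonneg fun _ _ => mul_self_nonneg _

theorem ip_neg_left {α β : Type*} [Fintype α] [Fintype β] (X Y : Matrix α β ℝ) :
    ip (-X) Y = -ip X Y := by
  simp [ip]

theorem ip_transpose {α β : Type*} [Fintype α] [Fintype β] (X Y : Matrix α β ℝ) :
    ip Xᵀ Yᵀ = ip X Y :=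
  Finset.sum_comm

theorem ip_fromBlocks {α β γ κ : Type*} [Fintype α] [Fintype β] [Fintype γ] [Fintype κ]
    (A A' : Matrix α γ ℝ) (B B' : Matrix α κ ℝ) (C C' : Matrix β γ ℝ) (D D' : Matrix β κ ℝ) :
    ip (fromBlocks A B C D) (fromBlocks A' B' C' D') = ip A A' + ip B B' + ip C C' + ip D D' := by
  simp only [ip, Fintype.sum_sum_type, fromBlocks_apply₁₁, fromBlocks_apply₁₂,
    fromBlocks_apply₂₁, fromBlocks_apply₂₂, Finset.sum_add_distrib]
  ring

theorem stack_gram_sub {m n r : ℕ} (U Us : Matrix (Fin m) (Fin r) ℝ)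
    (V Vs : Matrix (Fin n) (Fin r) ℝ) :
    stack U V * (stack U V)ᵀ - stack Us Vs * (stack Us Vs)ᵀ =
      fromBlocks (U * Uᵀ - Us * Usᵀ) (U * Vᵀ - Us * Vsᵀ)
        (U * Vᵀ - Us * Vsᵀ)ᵀ (V * Vᵀ - Vs * Vsᵀ) := by
  simp [stack, transpose_fromRows, sub_eq_add_neg, fromBlocks_neg,
    fromBlocks_add]

/-- for any `δ ≥ 0`,
`(1−δ)‖UVᵀ − U*V*ᵀ‖_F² + (1/4)⟨W̃W̃ᵀ − W̃*W̃*ᵀ, WWᵀ − W*W*ᵀ⟩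
  = (1−δ−1/2)‖UVᵀ − U*V*ᵀ‖_F² + (1/4)‖UUᵀ − U*U*ᵀ‖_F² + (1/4)‖VVᵀ − V*V*ᵀ‖_F²
  ≥ ((1−2δ)/4)‖WWᵀ − W*W*ᵀ‖_F²`. -/
theorem b1_b2_e_bound {m n r : ℕ} (δ : ℝ) (hδ : 0 ≤ δ)
    (U Us : Matrix (Fin m) (Fin r) ℝ) (V Vs : Matrix (Fin n) (Fin r) ℝ) :
    ((1 - δ) * fnorm (U * Vᵀ - Us * Vsᵀ) ^ 2
        + (1 / 4 : ℝ) *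
          ip (stack U (-V) * (stack U (-V))ᵀ - stack Us (-Vs) * (stack Us (-Vs))ᵀ)
            (stack U V * (stack U V)ᵀ - stack Us Vs * (stack Us Vs)ᵀ)
      = (1 - δ - 1 / 2) * fnorm (U * Vᵀ - Us * Vsᵀ) ^ 2
        + (1 / 4 : ℝ) * fnorm (U * Uᵀ - Us * Usᵀ) ^ 2
        + (1 / 4 : ℝ) * fnorm (V * Vᵀ - Vs * Vsᵀ) ^ 2) ∧
    (1 - 2 * δ) / 4 *
        fnorm (stack U V * (stack U V)ᵀ - stack Us Vs * (stack Us Vs)ᵀ) ^ 2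
      ≤ (1 - δ) * fnorm (U * Vᵀ - Us * Vsᵀ) ^ 2
        + (1 / 4 : ℝ) *
          ip (stack U (-V) * (stack U (-V))ᵀ - stack Us (-Vs) * (stack Us (-Vs))ᵀ)
            (stack U V * (stack U V)ᵀ - stack Us Vs * (stack Us Vs)ᵀ) := by
  have hneg : U * (-V)ᵀ - Us * (-Vs)ᵀ = -(U * Vᵀ - Us * Vsᵀ) := by
    simp only [transpose_neg, Matrix.mul_neg]
    abel
  have hU := ip_self_nonneg (U * Uᵀ - Us * Usᵀ)
  have hV := ip_self_nonneg (V * Vᵀ - Vs * Vsᵀ)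
  have hVV : -V * (-V)ᵀ - -Vs * (-Vs)ᵀ = V * Vᵀ - Vs * Vsᵀ := by simp
  simp only [stack_gram_sub, fnorm_sq, ip_fromBlocks, ip_transpose, hneg, hVV, ip_neg_left]
  refine ⟨by ring, ?_⟩
  nlinarith [mul_nonneg hδ hU, mul_nonneg hδ hV]
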